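/- arXiv:2506.01854 — 4 statements merged into one kernel-verified Lean document; each statement's English description precedes it below -/
import Mathlib

section
/- Let X be a random variable taking values in a finite set S, let R be uniform on S, and set ε = SD(X, R). If ε ≤ 1/4, then log₂|S| − H(X) ≤ 2ε·log₂|S| + 2√ε. -/
/-- Pointwise bound on the relative entropy of a probability `x` with respect to `1 / n`, in terms
of the positive part of `x - 1 / n`. -/
lemma mul_logb_add_mul_logb_le {n x : ℝ} (hn : 1 ≤ n) (hx0 : 0 ≤ x) (hx1 : x ≤ 1) :
    x * Real.logb 2 x + x * Real.logb 2 n ≤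
      (|x - n⁻¹| + (x - n⁻¹)) / 2 * (Real.logb 2 n + 2) := by
  have hn0 : 0 < n := by linarith
  have hlog_n : 0 ≤ Real.logb 2 n := Real.logb_nonneg one_lt_two hn
  have hpos : 0 ≤ (|x - n⁻¹| + (x - n⁻¹)) / 2 := by
    linarith [neg_abs_le (x - n⁻¹)]
  rcases hx0.eq_or_lt with rfl | hx
  · simpa using mul_nonneg hpos (by linarith : 0 ≤ Real.logb 2 n + 2)
  have hlog_mul : Real.logb 2 (x * n) = Real.logb 2 x + Real.logb 2 n :=
    Real.logb_mul hx.ne' hn0.ne'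
  rw [← mul_add, ← hlog_mul]
  rcases le_total x n⁻¹ with h | h
  · have hxn : x * n ≤ 1 := by
      calc x * n ≤ n⁻¹ * n := by gcongr
        _ = 1 := inv_mul_cancel₀ hn0.ne'
    have hlog : Real.logb 2 (x * n) ≤ 0 := Real.logb_nonpos one_lt_two (by positivity) hxn
    exact (mul_nonpos_of_nonneg_of_nonpos hx0 hlog).trans
      (mul_nonneg hpos (by linarith))
  · rw [abs_of_nonneg (sub_nonneg.2 h), add_self_div_two]
    have hlog_le : Real.logb 2 (x * n) ≤ Real.logb 2 n := by
      linarith [Real.logb_nonpos one_lt_two hx0 hx1]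
    have hxn : 1 ≤ x * n := by
      calc 1 = n⁻¹ * n := (inv_mul_cancel₀ hn0.ne').symm
        _ ≤ x * n := by gcongr
    have hlog_lin : Real.logb 2 (x * n) ≤ 2 * (x * n - 1) := by
      rw [Real.logb, div_le_iff₀ (Real.log_pos one_lt_two)]
      nlinarith [Real.log_le_sub_one_of_pos (by positivity : 0 < x * n), Real.log_two_gt_d9]
    calc x * Real.logb 2 (x * n)
        = (x - n⁻¹) * Real.logb 2 (x * n) + n⁻¹ * Real.logb 2 (x * n) := by ring
      _ ≤ (x - n⁻¹) * Real.logb 2 n + n⁻¹ * (2 * (x * n - 1)) := by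
        gcongr
      _ = (x - n⁻¹) * (Real.logb 2 n + 2) := by field_simp


/-- Let `X` be a random variable taking values in a finite set `S`
(given by its probability mass function `p`), let `R` be uniform on `S`, and set
`ε = SD(X, R)`.  If `ε ≤ 1/4`, then `log₂|S| − H(X) ≤ 2ε·log₂|S| + 2√ε`. -/
theorem entropy_gap_upper_bound {S : Type*} [Fintype S]
    (p : S → ℝ) (hp0 : ∀ s, 0 ≤ p s) (hp1 : ∑ s, p s = 1)
    (ε : ℝ)
    (hε : ε = (1 / 2) * ∑ s, |p s - (Fintype.card S : ℝ)⁻¹|)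
    (hε4 : ε ≤ 1 / 4) :
    Real.logb 2 (Fintype.card S) - (-∑ s, p s * Real.logb 2 (p s))
      ≤ 2 * ε * Real.logb 2 (Fintype.card S) + 2 * Real.sqrt ε := by
  have : Nonempty S := by
    by_contra h
    rw [not_nonempty_iff] at h
    simp at hp1
  have hcard : (1 : ℝ) ≤ Fintype.card S := by exact_mod_cast Fintype.card_pos (α := S)
  have hle : ∀ s, p s ≤ 1 := fun s ↦
    hp1 ▸ Finset.single_le_sum (fun i _ ↦ hp0 i) (Finset.mem_univ s)
  have hsub : ∑ s, (p s - (Fintype.card S : ℝ)⁻¹) = 0 := by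
    rw [Finset.sum_sub_distrib, hp1]
    simp
  have hsum := Finset.sum_le_sum fun s (_ : s ∈ Finset.univ) ↦
    mul_logb_add_mul_logb_le hcard (hp0 s) (hle s)
  rw [Finset.sum_add_distrib, ← Finset.sum_mul, ← Finset.sum_mul, ← Finset.sum_div,
    Finset.sum_add_distrib, hsub, hp1] at hsum
  have hε0 : 0 ≤ ε := by rw [hε]; positivity
  have hlog : 0 ≤ ε * Real.logb 2 (Fintype.card S) :=
    mul_nonneg hε0 (Real.logb_nonneg one_lt_two hcard)
  have hsqrt : ε ≤ Real.sqrt ε := Real.le_sqrt_of_sq_le (by nlinarith)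
  have hgap : ∑ s, p s * Real.logb 2 (p s) + 1 * Real.logb 2 (Fintype.card S) ≤
      ε * (Real.logb 2 (Fintype.card S) + 2) := by
    rwa [add_zero, div_eq_inv_mul, ← one_div, ← hε] at hsum
  linarith
end

section
/- Let {D_k}_{k∈{0,1}^ℓ} be a family of probability distributions over {0,1}^n. Let sk be uniformly random on {0,1}^ℓ and, conditioned on sk, let x, x₁, …, x_m be i.i.d. samples from D_sk. If the joint distribution of (x₁, …, x_m) is ε-close in statistical distance to the uniform distribution on ({0,1}^n)^m, where ε ≤ 1/4, then the joint distribution of (sk, x) is within statistical distance √(2εn + 2√ε/m + ℓ/m) of the uniform distribution on {0,1}^{ℓ+n}. -/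
/-- A weak form of Pinsker's inequality, obtained by way of the Hellinger distance. -/
theorem sq_sum_abs_sub_le_four_mul_sum_mul_log {α : Type*} [Fintype α] (p q : α → ℝ)
    (hp : ∀ a, 0 ≤ p a) (hq : ∀ a, 0 < q a) (hp1 : ∑ a, p a = 1) (hq1 : ∑ a, q a = 1) :
    (∑ a, |p a - q a|) ^ 2 ≤ 4 * ∑ a, p a * Real.log (p a / q a) := by
  have sq_p (a : α) : √(p a) ^ 2 = p a := Real.sq_sqrt (hp a)
  have sq_q (a : α) : √(q a) ^ 2 = q a := Real.sq_sqrt (hq a).le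
  have hellinger_le : ∑ a, (√(p a) - √(q a)) ^ 2 ≤ ∑ a, p a * Real.log (p a / q a) := by
    have pointwise (a : α) :
        (√(p a) - √(q a)) ^ 2 ≤ p a * Real.log (p a / q a) + (q a - p a) := by
      rcases (hp a).eq_or_lt with h | h
      · simp [← h, sq_q]
      · have hsp := Real.sqrt_pos.2 h
        have hsq := Real.sqrt_pos.2 (hq a)
        have hlog : Real.log (p a / q a) = -(2 * Real.log (√(q a) / √(p a))) := by
          rw [Real.log_div h.ne' (hq a).ne', Real.log_div hsq.ne' hsp.ne',
            Real.log_sqrt (hp a), Real.log_sqrt (hq a).le]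
          ring
        have hle := Real.log_le_sub_one_of_pos (div_pos hsq hsp)
        have hmul : p a * (√(q a) / √(p a)) = √(p a) * √(q a) := by
          rw [← mul_div_assoc, div_eq_iff hsp.ne']
          linear_combination -√(q a) * sq_p a
        have := mul_le_mul_of_nonneg_left hle (hp a)
        rw [hlog]
        nlinarith [sq_p a, sq_q a]
    calc ∑ a, (√(p a) - √(q a)) ^ 2
        ≤ ∑ a, (p a * Real.log (p a / q a) + (q a - p a)) :=
          Finset.sum_le_sum fun a _ => pointwise a
      _ = ∑ a, p a * Real.log (p a / q a) := by
          rw [Finset.sum_add_distrib, Finset.sum_sub_distrib, hp1, hq1]; ring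
  have sum_le_four : ∑ a, (√(p a) + √(q a)) ^ 2 ≤ 4 := by
    calc ∑ a, (√(p a) + √(q a)) ^ 2 ≤ ∑ a, (2 * p a + 2 * q a) :=
          Finset.sum_le_sum fun a _ => by
            nlinarith [sq_p a, sq_q a, sq_nonneg (√(p a) - √(q a))]
      _ = 4 := by
          rw [Finset.sum_add_distrib, ← Finset.mul_sum, ← Finset.mul_sum, hp1, hq1]; norm_num
  have factor (a : α) : |p a - q a| = |√(p a) - √(q a)| * (√(p a) + √(q a)) := by
    rw [← abs_of_nonneg (add_nonneg (Real.sqrt_nonneg (p a)) (Real.sqrt_nonneg (q a))),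
      ← abs_mul]
    congr 1
    linear_combination sq_q a - sq_p a
  calc (∑ a, |p a - q a|) ^ 2
      = (∑ a, |√(p a) - √(q a)| * (√(p a) + √(q a))) ^ 2 := by simp_rw [factor]
    _ ≤ (∑ a, |√(p a) - √(q a)| ^ 2) * ∑ a, (√(p a) + √(q a)) ^ 2 :=
        Finset.sum_mul_sq_le_sq_mul_sq _ _ _
    _ ≤ (∑ a, p a * Real.log (p a / q a)) * 4 := by
        simp_rw [sq_abs]
        exact mul_le_mul hellinger_le sum_le_four (Finset.sum_nonneg fun a _ => sq_nonneg _)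
          ((Finset.sum_nonneg fun a _ => sq_nonneg _).trans hellinger_le)
    _ = 4 * ∑ a, p a * Real.log (p a / q a) := mul_comm _ _

theorem sum_prod_mul_apply_eq {ι β : Type*} [Fintype ι] [DecidableEq ι] [Fintype β]
    (f g : β → ℝ) (hf : ∑ b, f b = 1) (i : ι) :
    ∑ v : ι → β, (∏ j, f (v j)) * g (v i) = ∑ b, f b * g b := by
  have split (v : ι → β) :
      (∏ j, f (v j)) * g (v i) = ∏ j, f (v j) * (if j = i then g (v j) else 1) := by
    rw [Finset.prod_mul_distrib]
    simp
  simp_rw [split]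
  rw [← Fintype.prod_sum (f := fun j b => f b * (if j = i then g b else 1)),
    Finset.prod_eq_single i]
  · simp
  · intro j _ hj
    simp [hj, hf]
  · simp

theorem sum_prod_mul_log_prod {ι β : Type*} [Fintype ι] [DecidableEq ι] [Fintype β]
    (f : β → ℝ) (hf : ∑ b, f b = 1) {c : ℝ} (hc : c ≠ 0) :
    ∑ v : ι → β, (∏ j, f (v j)) * Real.log ((∏ j, f (v j)) * c ^ Fintype.card ι)
      = Fintype.card ι * ∑ b, f b * Real.log (f b * c) := by
  have expand (v : ι → β) :
      (∏ j, f (v j)) * Real.log ((∏ j, f (v j)) * c ^ Fintype.card ι)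
        = ∑ i, (∏ j, f (v j)) * Real.log (f (v i) * c) := by
    by_cases h : ∏ j, f (v j) = 0
    · simp [h]
    · rw [← Finset.mul_sum, ← Real.log_prod]
      · simp [Finset.prod_mul_distrib]
      · exact fun j hj => mul_ne_zero (Finset.prod_ne_zero_iff.1 h j hj) hc
  simp_rw [expand]
  rw [Finset.sum_comm,
    Finset.sum_congr rfl fun i _ =>
      sum_prod_mul_apply_eq f (fun b => Real.log (f b * c)) hf i]
  simp

theorem mul_log_mul_le_abs_sub_inv_mul {p N : ℝ} (hp : 0 ≤ p) (hp1 : p ≤ 1) (hN : 1 ≤ N) :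
    p * Real.log (p * N) ≤ |p - N⁻¹| * (Real.log N + 1) := by
  have hN0 : 0 < N := by linarith
  have hlogN := Real.log_nonneg hN
  rcases le_total (p * N) 1 with h | h
  · exact (mul_nonpos_of_nonneg_of_nonpos hp
      (Real.log_nonpos (mul_nonneg hp hN0.le) h)).trans (by positivity)
  · have hinv : N⁻¹ ≤ p := (inv_le_iff_one_le_mul₀ hN0).2 h
    rw [abs_of_nonneg (sub_nonneg.2 hinv)]
    have hlog_le : Real.log (p * N) ≤ Real.log N :=
      Real.log_le_log (by linarith) (by nlinarith)
    have hlog_sub := Real.log_le_sub_one_of_pos (show 0 < p * N by linarith)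
    have hexcess := mul_le_mul_of_nonneg_left hlog_le (sub_nonneg.2 hinv)
    have hbase := mul_le_mul_of_nonneg_left hlog_sub (inv_nonneg.2 hN0.le)
    have hcancel : N⁻¹ * (p * N - 1) = p - N⁻¹ := by field_simp
    nlinarith

/-- With `N` the cardinality of `α`, this bounds the relative entropy of a distribution with
respect to the uniform one by their distance. -/
theorem sum_mul_log_mul_le_sum_abs_sub_inv_mul {α : Type*} [Fintype α] (p : α → ℝ)
    (hp : ∀ a, 0 ≤ p a) (hp1 : ∑ a, p a = 1) {N : ℝ} (hN : 1 ≤ N) :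
    ∑ a, p a * Real.log (p a * N) ≤ (∑ a, |p a - N⁻¹|) * (Real.log N + 1) := by
  rw [Finset.sum_mul]
  refine Finset.sum_le_sum fun a _ => mul_log_mul_le_abs_sub_inv_mul (hp a) ?_ hN
  exact hp1 ▸ Finset.single_le_sum (fun b _ => hp b) (Finset.mem_univ a)

/-- The average relative entropy of the components of a uniform mixture exceeds that of the
mixture by at most the logarithm of the number of components. -/
theorem sum_sum_mul_log_le_of_mixture {κ α : Type*} [Fintype κ] [Fintype α] (P : κ → α → ℝ)
    (hP : ∀ k a, 0 ≤ P k a) (hP1 : ∀ k, ∑ a, P k a = 1) {K N : ℝ} (hK : 0 < K)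
    (hcard : (Fintype.card κ : ℝ) = K) (hN : 0 < N) :
    ∑ k, K⁻¹ * ∑ a, P k a * Real.log (P k a * N)
      ≤ ∑ a, (∑ k, K⁻¹ * P k a) * Real.log ((∑ k, K⁻¹ * P k a) * N) + Real.log K := by
  have pointwise (k : κ) (a : α) : K⁻¹ * (P k a * Real.log (P k a * N))
      ≤ K⁻¹ * P k a * (Real.log ((∑ k, K⁻¹ * P k a) * N) + Real.log K) := by
    rcases (hP k a).eq_or_lt with h | h
    · simp [← h]
    · have hle : K⁻¹ * P k a ≤ ∑ k, K⁻¹ * P k a :=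
        Finset.single_le_sum (f := fun k => K⁻¹ * P k a)
          (fun j _ => mul_nonneg (inv_nonneg.2 hK.le) (hP j a)) (Finset.mem_univ k)
      have hpos : 0 < ∑ k, K⁻¹ * P k a := (mul_pos (inv_pos.2 hK) h).trans_le hle
      have hle' : P k a ≤ (∑ k, K⁻¹ * P k a) * K := by
        rwa [inv_mul_le_iff₀ hK, mul_comm] at hle
      rw [mul_assoc]
      refine mul_le_mul_of_nonneg_left (mul_le_mul_of_nonneg_left ?_ h.le)
        (inv_nonneg.2 hK.le)
      rw [← Real.log_mul (mul_pos hpos hN).ne' hK.ne']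
      exact Real.log_le_log (mul_pos h hN) (by nlinarith)
  have total : ∑ a, ∑ k, K⁻¹ * P k a = 1 := by
    rw [Finset.sum_comm]
    simp_rw [← Finset.mul_sum, hP1]
    simp [hcard, hK.ne']
  calc ∑ k, K⁻¹ * ∑ a, P k a * Real.log (P k a * N)
      = ∑ a, ∑ k, K⁻¹ * (P k a * Real.log (P k a * N)) := by
        simp_rw [Finset.mul_sum]; exact Finset.sum_comm
    _ ≤ ∑ a, ∑ k, K⁻¹ * P k a * (Real.log ((∑ k, K⁻¹ * P k a) * N) + Real.log K) :=
        Finset.sum_le_sum fun a _ => Finset.sum_le_sum fun k _ => pointwise k a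
    _ = _ := by
        simp_rw [← Finset.sum_mul, mul_add]
        rw [Finset.sum_add_distrib, ← Finset.sum_mul, total, one_mul]


/-- Let `{D_k}_{k ∈ {0,1}^ℓ}` be a family of probability distributions
over `{0,1}^n`.  Let `sk` be uniformly random on `{0,1}^ℓ` and, conditioned on `sk`, let
`x, x₁, …, x_m` be i.i.d. samples from `D_sk`.  If the joint distribution of
`(x₁, …, x_m)` is `ε`-close in statistical distance to the uniform distribution on
`({0,1}^n)^m`, where `ε ≤ 1/4`, then the joint distribution of `(sk, x)` is within
statistical distance `√(2εn + 2√ε/m + ℓ/m)` of the uniform distribution on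
`{0,1}^{ℓ+n}`. -/
theorem key_plus_sample_close_to_uniform {l n m : ℕ} (hm : 0 < m)
    (D : (Fin l → Bool) → (Fin n → Bool) → ℝ)
    (hD0 : ∀ k y, 0 ≤ D k y) (hD1 : ∀ k, ∑ y, D k y = 1)
    (ε : ℝ) (hε4 : ε ≤ 1 / 4)
    (hclose : (1 / 2) * ∑ v : Fin m → (Fin n → Bool),
        |(∑ k, (2 ^ l : ℝ)⁻¹ * ∏ i, D k (v i)) - ((2 ^ n : ℝ) ^ m)⁻¹| ≤ ε) :
    (1 / 2) * ∑ k, ∑ y, |(2 ^ l : ℝ)⁻¹ * D k y - (2 ^ (l + n) : ℝ)⁻¹|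
      ≤ Real.sqrt (2 * ε * n + 2 * Real.sqrt ε / m + l / m) := by
  have hε0 : 0 ≤ ε := le_trans (by positivity) hclose
  have hm' : (0 : ℝ) < m := Nat.cast_pos.2 hm
  set P : (Fin l → Bool) → (Fin m → Fin n → Bool) → ℝ := fun k v => ∏ i, D k (v i) with hPdef
  have hP0 (k : Fin l → Bool) (v : Fin m → Fin n → Bool) : 0 ≤ P k v :=
    Finset.prod_nonneg fun i _ => hD0 k (v i)
  have hP1 (k : Fin l → Bool) : ∑ v, P k v = 1 := by
    rw [hPdef, ← Fintype.prod_sum (f := fun (_ : Fin m) y => D k y)]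
    simp [hD1]
  have hcard : (Fintype.card (Fin l → Bool) : ℝ) = 2 ^ l := by simp
  set S := ∑ k, (2 ^ l : ℝ)⁻¹ * ∑ y, D k y * Real.log (D k y * 2 ^ n) with hS
  have tensor : ∑ k, (2 ^ l : ℝ)⁻¹ * ∑ v, P k v * Real.log (P k v * (2 ^ n : ℝ) ^ m)
      = m * S := by
    rw [hS, Finset.mul_sum]
    refine Finset.sum_congr rfl fun k _ => ?_
    have h := sum_prod_mul_log_prod (ι := Fin m) (D k) (hD1 k) (c := (2 : ℝ) ^ n)
      (by positivity)
    rw [Fintype.card_fin] at h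
    rw [h]
    ring
  have mixture := sum_sum_mul_log_le_of_mixture P hP0 hP1 (K := 2 ^ l) (N := (2 ^ n : ℝ) ^ m)
    (by positivity) hcard (by positivity)
  have near_uniform := sum_mul_log_mul_le_sum_abs_sub_inv_mul (fun v => ∑ k, (2 ^ l : ℝ)⁻¹ * P k v)
    (fun v => Finset.sum_nonneg fun k _ => mul_nonneg (by positivity) (hP0 k v))
    (by
      rw [Finset.sum_comm]
      simp_rw [← Finset.mul_sum, hP1]
      simp)
    (N := (2 ^ n : ℝ) ^ m) (one_le_pow₀ (one_le_pow₀ one_le_two))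
  have hlog2 : Real.log 2 ≤ 1 := by linarith [Real.log_two_lt_d9]
  have hlog2' : 0 ≤ Real.log 2 := Real.log_nonneg one_le_two
  have hlogN : Real.log ((2 ^ n : ℝ) ^ m) ≤ m * n := by
    rw [Real.log_pow, Real.log_pow]
    gcongr
    exact mul_le_of_le_one_right (Nat.cast_nonneg n) hlog2
  have hlogK : Real.log ((2 : ℝ) ^ l) ≤ l := by
    rw [Real.log_pow]
    exact mul_le_of_le_one_right (Nat.cast_nonneg l) hlog2
  have hlogN0 : 0 ≤ Real.log ((2 ^ n : ℝ) ^ m) := by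
    rw [Real.log_pow, Real.log_pow]
    positivity
  have hεsqrt : ε ≤ √ε := Real.le_sqrt_of_sq_le (by nlinarith)
  have hmS : m * S ≤ 2 * ε * (m * n + 1) + l := by
    have hscale := mul_le_mul_of_nonneg_right
      (show ∑ v, |(∑ k, (2 ^ l : ℝ)⁻¹ * P k v) - ((2 ^ n : ℝ) ^ m)⁻¹| ≤ 2 * ε by
        linarith [hclose])
      (show 0 ≤ Real.log ((2 ^ n : ℝ) ^ m) + 1 by linarith)
    have := mul_le_mul_of_nonneg_left hlogN hε0
    linarith
  have hSle : S ≤ 2 * ε * n + 2 * √ε / m + l / m := by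
    have heq : 2 * ε * n + 2 * √ε / m + l / m = (2 * ε * (m * n) + 2 * √ε + l) / m := by
      field_simp
    rw [heq, le_div_iff₀ hm']
    linarith
  have pinsker := sq_sum_abs_sub_le_four_mul_sum_mul_log
    (α := (Fin l → Bool) × (Fin n → Bool))
    (fun z => (2 ^ l : ℝ)⁻¹ * D z.1 z.2) (fun _ => (2 ^ (l + n) : ℝ)⁻¹)
    (fun z => mul_nonneg (by positivity) (hD0 _ _)) (fun _ => by positivity)
    (by
      rw [Fintype.sum_prod_type]
      simp_rw [← Finset.mul_sum, hD1]
      simp)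
    (by
      simp [pow_add]
      field_simp)
  have hentropy : ∑ z : (Fin l → Bool) × (Fin n → Bool), (2 ^ l : ℝ)⁻¹ * D z.1 z.2 *
      Real.log ((2 ^ l : ℝ)⁻¹ * D z.1 z.2 / (2 ^ (l + n) : ℝ)⁻¹) = S := by
    rw [hS, Fintype.sum_prod_type]
    refine Finset.sum_congr rfl fun k _ => ?_
    rw [Finset.mul_sum]
    refine Finset.sum_congr rfl fun y _ => ?_
    have harg : (2 ^ l : ℝ)⁻¹ * D k y / (2 ^ (l + n) : ℝ)⁻¹ = D k y * 2 ^ n := by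
      rw [pow_add]
      field_simp
    rw [harg, mul_assoc]
  rw [hentropy, Fintype.sum_prod_type] at pinsker
  refine Real.le_sqrt_of_sq_le ?_
  rw [mul_pow]
  linarith
end

section
/- (Hypercontractivity on the Boolean cube) For every function f : {0,1}^n → ℝ and every ρ ∈ [0,1], ‖T_ρ f‖₂ ≤ ‖f‖_{1+ρ²}, where norms are with respect to the uniform distribution on {0,1}^n. -/
/-- The probability that the noise channel `N_ρ` maps `x` to `y`: each bit of `x` is kept
with probability `(1+ρ)/2` and flipped with probability `(1-ρ)/2`. -/
noncomputable def noiseK (ρ : ℝ) {n : ℕ} (x y : Fin n → Bool) : ℝ :=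
  ∏ i, if y i = x i then (1 + ρ) / 2 else (1 - ρ) / 2

/-- The noise operator `T_ρ`: `(T_ρ f)(x) = E_{y ← N_ρ(x)}[f(y)]`. -/
noncomputable def Tnoise (ρ : ℝ) {n : ℕ} (f : (Fin n → Bool) → ℝ) (x : Fin n → Bool) : ℝ :=
  ∑ y, noiseK ρ x y * f y

/-- The `ℓ`-norm of `f : {0,1}^n → ℝ` with respect to the uniform distribution:
`‖f‖_ℓ = (E_x[|f(x)|^ℓ])^{1/ℓ}`. -/
noncomputable def pnorm {n : ℕ} (l : ℝ) (f : (Fin n → Bool) → ℝ) : ℝ :=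
  ((2 ^ n : ℝ)⁻¹ * ∑ x, |f x| ^ l) ^ (1 / l)

theorem two_le_rpow_one_add_add_rpow_one_sub {q y : ℝ} (hq : q ≤ 0) (h1 : -1 < y) (h2 : y < 1) :
    2 ≤ (1 + y) ^ q + (1 - y) ^ q := by
  have hu : 0 < 1 + y := by linarith
  have hv : 0 < 1 - y := by linarith
  have hA := Real.rpow_pos_of_pos hu q
  have hB := Real.rpow_pos_of_pos hv q
  have hAB : 1 ≤ (1 + y) ^ q * (1 - y) ^ q := by
    rw [← Real.mul_rpow hu.le hv.le]
    exact Real.one_le_rpow_of_pos_of_le_one_of_nonpos (mul_pos hu hv)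
      (by nlinarith [sq_nonneg y]) hq
  nlinarith [sq_nonneg ((1 + y) ^ q - (1 - y) ^ q)]

theorem two_add_mul_sq_le_rpow_one_add_add_rpow_one_sub {p y : ℝ} (h1 : 1 ≤ p) (h2 : p ≤ 2)
    (hy : y ∈ Set.Icc (-1 : ℝ) 1) :
    2 + p * (p - 1) * y ^ 2 ≤ (1 + y) ^ p + (1 - y) ^ p := by
  set g : ℝ → ℝ := fun y => (1 + y) ^ p + (1 - y) ^ p - p * (p - 1) * y ^ 2 with hg
  have hconv : ConvexOn ℝ (Set.Icc (-1 : ℝ) 1) g := by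
    refine convexOn_of_hasDerivWithinAt2_nonneg (convex_Icc _ _)
      (f' := fun y => p * (1 + y) ^ (p - 1) - p * (1 - y) ^ (p - 1) - p * (p - 1) * (2 * y))
      (f'' := fun y => p * ((p - 1) * (1 + y) ^ (p - 1 - 1))
        + p * ((p - 1) * (1 - y) ^ (p - 1 - 1)) - p * (p - 1) * 2) ?_ ?_ ?_ ?_
    · have hp : 0 ≤ p := by linarith
      refine Continuous.continuousOn ?_
      refine ((Continuous.rpow_const (by fun_prop) fun _ => Or.inr hp).add
        (Continuous.rpow_const (by fun_prop) fun _ => Or.inr hp)).sub (by fun_prop)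
    · intro x hx
      rw [interior_Icc] at hx
      have hu : 1 + x ≠ 0 := by linarith [hx.1]
      have hv : 1 - x ≠ 0 := by linarith [hx.2]
      refine (HasDerivAt.congr_deriv (((((hasDerivAt_id x).const_add 1).rpow_const (p := p) (Or.inl hu)).add
        (((hasDerivAt_id x).const_sub 1).rpow_const (p := p) (Or.inl hv))).sub
        (((hasDerivAt_id x).pow 2).const_mul (p * (p - 1)))) ?_).hasDerivWithinAt
      simp only [id]; push_cast; ring
    · intro x hx
      rw [interior_Icc] at hx
      have hu : 1 + x ≠ 0 := by linarith [hx.1]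
      have hv : 1 - x ≠ 0 := by linarith [hx.2]
      refine (HasDerivAt.congr_deriv ((((((hasDerivAt_id x).const_add 1).rpow_const (p := p - 1) (Or.inl hu)).const_mul
        p).sub ((((hasDerivAt_id x).const_sub 1).rpow_const (p := p - 1) (Or.inl hv)).const_mul
        p)).sub (((hasDerivAt_id x).const_mul 2).const_mul (p * (p - 1)))) ?_).hasDerivWithinAt
      simp only [id]; ring
    · intro x hx
      rw [interior_Icc] at hx
      have := two_le_rpow_one_add_add_rpow_one_sub (q := p - 1 - 1) (by linarith) hx.1 hx.2
      have hp : 0 ≤ p * (p - 1) := mul_nonneg (by linarith) (by linarith)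
      nlinarith [mul_le_mul_of_nonneg_left this hp]
  have hy' : -y ∈ Set.Icc (-1 : ℝ) 1 := ⟨by linarith [hy.2], by linarith [hy.1]⟩
  have hmid := hconv.2 hy hy' (show (0 : ℝ) ≤ 1 / 2 by norm_num) (show (0 : ℝ) ≤ 1 / 2 by norm_num)
    (by norm_num)
  have h0 : (1 / 2 : ℝ) • y + (1 / 2 : ℝ) • (-y) = 0 := by simp
  rw [h0] at hmid
  simp only [hg, smul_eq_mul, add_zero, sub_zero, Real.one_rpow, sub_neg_eq_add, neg_sq,
    ← sub_eq_add_neg] at hmid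
  linarith

theorem two_point_inequality_of_abs_le {p a b : ℝ} (h1 : 1 ≤ p) (h2 : p ≤ 2) (hab : |b| ≤ |a|) :
    (a ^ 2 + (p - 1) * b ^ 2) ^ (p / 2) ≤ (|a + b| ^ p + |a - b| ^ p) / 2 := by
  rcases eq_or_ne a 0 with rfl | ha
  · obtain rfl : b = 0 := by simpa using hab
    simp [Real.zero_rpow (show p ≠ 0 by linarith), Real.zero_rpow (show p / 2 ≠ 0 by linarith)]
  have hapos : 0 < |a| := abs_pos.2 ha
  obtain ⟨y, rfl⟩ : ∃ y, b = a * y := ⟨b / a, by field_simp⟩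
  have hy : |y| ≤ 1 := by
    rw [abs_mul] at hab
    exact le_of_mul_le_mul_left (by simpa using hab) hapos
  have hy' := abs_le.1 hy
  have hfac : a ^ 2 + (p - 1) * (a * y) ^ 2 = |a| ^ 2 * (1 + (p - 1) * y ^ 2) := by
    rw [sq_abs]; ring
  have hs : 0 ≤ (p - 1) * y ^ 2 := mul_nonneg (by linarith) (sq_nonneg y)
  have hsq : (|a| ^ 2) ^ (p / 2) = |a| ^ p := by
    rw [← Real.rpow_natCast, ← Real.rpow_mul hapos.le]
    congr 1; push_cast; ring
  have hplus : |a + a * y| = |a| * (1 + y) := by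
    rw [← mul_one_add, abs_mul, abs_of_nonneg (show 0 ≤ 1 + y by linarith)]
  have hminus : |a - a * y| = |a| * (1 - y) := by
    rw [← mul_one_sub, abs_mul, abs_of_nonneg (show 0 ≤ 1 - y by linarith)]
  rw [hfac, hplus, hminus, Real.mul_rpow (by positivity) (by linarith), hsq,
    Real.mul_rpow hapos.le (by linarith), Real.mul_rpow hapos.le (by linarith)]
  have hB := rpow_one_add_le_one_add_mul_self (s := (p - 1) * y ^ 2) (p := p / 2)
    (by linarith) (by linarith) (by linarith)
  have hC := two_add_mul_sq_le_rpow_one_add_add_rpow_one_sub h1 h2 hy'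
  have hD : (1 + (p - 1) * y ^ 2) ^ (p / 2) ≤ ((1 + y) ^ p + (1 - y) ^ p) / 2 := by linarith
  calc _ ≤ |a| ^ p * (((1 + y) ^ p + (1 - y) ^ p) / 2) := by gcongr
    _ = _ := by ring

/-- The two-point inequality of Bonami and Beckner. -/
theorem two_point_inequality {p : ℝ} (h1 : 1 ≤ p) (h2 : p ≤ 2) (a b : ℝ) :
    (a ^ 2 + (p - 1) * b ^ 2) ^ (p / 2) ≤ (|a + b| ^ p + |a - b| ^ p) / 2 := by
  rcases le_total |b| |a| with h | h
  · exact two_point_inequality_of_abs_le h1 h2 h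
  · have := two_point_inequality_of_abs_le h1 h2 h
    rw [add_comm b a, abs_sub_comm b a] at this
    refine le_trans (Real.rpow_le_rpow ?_ ?_ (by linarith)) this
    · have := mul_nonneg (sub_nonneg.2 h1) (sq_nonneg b)
      positivity
    · nlinarith [sq_le_sq.2 h]

theorem sum_bool_cube_succ {n : ℕ} (F : (Fin (n + 1) → Bool) → ℝ) :
    ∑ x, F x = ∑ x : Fin n → Bool, (F (Fin.cons true x) + F (Fin.cons false x)) := by
  rw [← (Fin.consEquiv fun _ => Bool).sum_comp, Fintype.sum_prod_type, Fintype.sum_bool,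
    ← Finset.sum_add_distrib]
  rfl

theorem noiseK_cons (ρ : ℝ) {n : ℕ} (b c : Bool) (x y : Fin n → Bool) :
    noiseK ρ (Fin.cons b x : Fin (n + 1) → Bool) (Fin.cons c y) =
      (if c = b then (1 + ρ) / 2 else (1 - ρ) / 2) * noiseK ρ x y := by
  simp [noiseK, Fin.prod_univ_succ]

theorem Tnoise_cons (ρ : ℝ) {n : ℕ} (f : (Fin (n + 1) → Bool) → ℝ) (b : Bool)
    (x : Fin n → Bool) :
    Tnoise ρ f (Fin.cons b x) = (1 + ρ) / 2 * Tnoise ρ (fun y => f (Fin.cons b y)) x +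
      (1 - ρ) / 2 * Tnoise ρ (fun y => f (Fin.cons (!b) y)) x := by
  simp only [Tnoise, sum_bool_cube_succ, noiseK_cons, Finset.mul_sum, ← Finset.sum_add_distrib]
  refine Finset.sum_congr rfl fun y _ => ?_
  cases b <;> simp <;> ring

/-- Minkowski's inequality in `ℓ^{2/p}`, applied to the `p`-th powers of two functions. -/
theorem sum_rpow_add_rpow_le {ι : Type*} (s : Finset ι) (g h : ι → ℝ) {p : ℝ}
    (h1 : 1 ≤ p) (h2 : p ≤ 2) :
    (∑ x ∈ s, (|g x| ^ p + |h x| ^ p) ^ (2 / p)) ^ (p / 2) ≤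
      (∑ x ∈ s, g x ^ 2) ^ (p / 2) + (∑ x ∈ s, h x ^ 2) ^ (p / 2) := by
  have hp : 0 < p := by linarith
  have key := Real.Lp_add_le s (fun x => |g x| ^ p) (fun x => |h x| ^ p) (p := 2 / p)
    ((one_le_div hp).2 h2)
  have hpow (t : ℝ) : (|t| ^ p) ^ (2 / p) = t ^ 2 := by
    rw [← Real.rpow_mul (abs_nonneg t), mul_div_cancel₀ _ hp.ne', Real.rpow_two, sq_abs]
  have habs (t : ℝ) : |(|t| ^ p)| = |t| ^ p := abs_of_nonneg (by positivity)
  have hadd (t u : ℝ) : |(|t| ^ p + |u| ^ p)| = |t| ^ p + |u| ^ p := abs_of_nonneg (by positivity)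
  simpa only [one_div_div, habs, hadd, hpow] using key

theorem rpow_mean_sq_Tnoise_le {n : ℕ} (f : (Fin n → Bool) → ℝ) {ρ : ℝ}
    (hρ : ρ ∈ Set.Icc (0 : ℝ) 1) :
    ((2 ^ n : ℝ)⁻¹ * ∑ x, Tnoise ρ f x ^ 2) ^ ((1 + ρ ^ 2) / 2) ≤
      (2 ^ n : ℝ)⁻¹ * ∑ x, |f x| ^ (1 + ρ ^ 2) := by
  have h1 : 1 ≤ 1 + ρ ^ 2 := by nlinarith [sq_nonneg ρ]
  have h2 : 1 + ρ ^ 2 ≤ 2 := by nlinarith [hρ.1, hρ.2]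
  have hsub : 1 + ρ ^ 2 - 1 = ρ ^ 2 := by ring
  have two_point := two_point_inequality h1 h2
  rw [hsub] at two_point
  set p := 1 + ρ ^ 2
  have hp : 0 < p := by linarith
  induction n with
  | zero =>
    have hT (x : Fin 0 → Bool) : Tnoise ρ f x = f x := by
      simp [Tnoise, noiseK, Subsingleton.elim _ x]
    simp only [pow_zero, inv_one, one_mul, Fintype.sum_unique, hT]
    rw [← sq_abs, ← Real.rpow_natCast, ← Real.rpow_mul (abs_nonneg _), Nat.cast_ofNat,
      mul_div_cancel₀ p two_ne_zero]
  | succ n ih =>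
    set g := Tnoise ρ fun y => f (Fin.cons true y)
    set h := Tnoise ρ fun y => f (Fin.cons false y)
    have hN : (0 : ℝ) ≤ (2 ^ n : ℝ)⁻¹ := by positivity
    have pointwise (x : Fin n → Bool) :
        Tnoise ρ f (Fin.cons true x) ^ 2 + Tnoise ρ f (Fin.cons false x) ^ 2 ≤
          2 * ((1 / 2) ^ (2 / p) * (|g x| ^ p + |h x| ^ p) ^ (2 / p)) := by
      have tp := two_point ((g x + h x) / 2) ((g x - h x) / 2)
      have e1 : (g x + h x) / 2 + (g x - h x) / 2 = g x := by ring
      have e2 : (g x + h x) / 2 - (g x - h x) / 2 = h x := by ring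
      rw [e1, e2] at tp
      have tp' := Real.rpow_le_rpow (by positivity) tp (show 0 ≤ 2 / p by positivity)
      rw [← Real.rpow_mul (by positivity), show p / 2 * (2 / p) = 1 by field_simp, Real.rpow_one,
        div_eq_mul_one_div (|g x| ^ p + |h x| ^ p), mul_comm _ (1 / 2 : ℝ),
        Real.mul_rpow (by norm_num) (by positivity)] at tp'
      rw [Tnoise_cons, Tnoise_cons]
      simp only [Bool.not_true, Bool.not_false]
      calc _ = 2 * (((g x + h x) / 2) ^ 2 + ρ ^ 2 * ((g x - h x) / 2) ^ 2) := by ring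
        _ ≤ _ := by gcongr
    have hsum : (2 ^ (n + 1) : ℝ)⁻¹ * ∑ x, Tnoise ρ f x ^ 2 ≤
        (2 ^ n : ℝ)⁻¹ * ((1 / 2) ^ (2 / p) * ∑ x, (|g x| ^ p + |h x| ^ p) ^ (2 / p)) := by
      rw [sum_bool_cube_succ]
      calc _ ≤ (2 ^ (n + 1) : ℝ)⁻¹ *
            ∑ x, 2 * ((1 / 2) ^ (2 / p) * (|g x| ^ p + |h x| ^ p) ^ (2 / p)) := by
              gcongr with x; exact pointwise x
        _ = _ := by rw [← Finset.mul_sum, ← Finset.mul_sum, pow_succ]; field_simp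
    have hnn (k : (Fin n → Bool) → ℝ) : 0 ≤ ∑ x, k x ^ 2 := by positivity
    calc _ ≤ ((2 ^ n : ℝ)⁻¹ *
          ((1 / 2) ^ (2 / p) * ∑ x, (|g x| ^ p + |h x| ^ p) ^ (2 / p))) ^ (p / 2) :=
          Real.rpow_le_rpow (by positivity) hsum (by positivity)
      _ = 1 / 2 * (((2 ^ n : ℝ)⁻¹) ^ (p / 2) *
          (∑ x, (|g x| ^ p + |h x| ^ p) ^ (2 / p)) ^ (p / 2)) := by
        rw [Real.mul_rpow hN (by positivity), Real.mul_rpow (by positivity) (by positivity),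
          ← Real.rpow_mul (by norm_num), show 2 / p * (p / 2) = 1 by field_simp, Real.rpow_one]
        ring
      _ ≤ 1 / 2 * (((2 ^ n : ℝ)⁻¹) ^ (p / 2) *
          ((∑ x, g x ^ 2) ^ (p / 2) + (∑ x, h x ^ 2) ^ (p / 2))) := by
        gcongr; exact sum_rpow_add_rpow_le _ g h h1 h2
      _ = 1 / 2 * (((2 ^ n : ℝ)⁻¹ * ∑ x, g x ^ 2) ^ (p / 2) +
          ((2 ^ n : ℝ)⁻¹ * ∑ x, h x ^ 2) ^ (p / 2)) := by
        rw [Real.mul_rpow hN (hnn g), Real.mul_rpow hN (hnn h)]; ring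
      _ ≤ 1 / 2 * ((2 ^ n : ℝ)⁻¹ * ∑ x, |f (Fin.cons true x)| ^ p +
          (2 ^ n : ℝ)⁻¹ * ∑ x, |f (Fin.cons false x)| ^ p) := by
        gcongr
        · exact ih _
        · exact ih _
      _ = _ := by
        rw [sum_bool_cube_succ, Finset.sum_add_distrib, pow_succ, mul_inv]; ring

/-- **Hypercontractivity on the Boolean cube.**
For every `f : {0,1}^n → ℝ` and every `ρ ∈ [0,1]`, `‖T_ρ f‖₂ ≤ ‖f‖_{1+ρ²}`. -/
theorem hypercontractivity {n : ℕ} (f : (Fin n → Bool) → ℝ)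
    (ρ : ℝ) (hρ : ρ ∈ Set.Icc (0 : ℝ) 1) :
    pnorm 2 (Tnoise ρ f) ≤ pnorm (1 + ρ ^ 2) f := by
  have key := rpow_mean_sq_Tnoise_le f hρ
  have hp : 0 < 1 + ρ ^ 2 := by positivity
  have hS : 0 ≤ (2 ^ n : ℝ)⁻¹ * ∑ x, Tnoise ρ f x ^ 2 := by positivity
  have := Real.rpow_le_rpow (by positivity) key (show 0 ≤ 1 / (1 + ρ ^ 2) by positivity)
  rw [← Real.rpow_mul hS, show (1 + ρ ^ 2) / 2 * (1 / (1 + ρ ^ 2)) = 1 / 2 by field_simp] at this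
  simpa only [pnorm, Real.rpow_two, sq_abs] using this
end

section
/- (No statistically pseudorandom codes in the standard model) Let ρ ∈ [0,1], let sk be uniform on {0,1}^ℓ, let Enc be a randomized encoder mapping sk to a codeword in {0,1}^n, and let Dec be a randomized decoder mapping a key in {0,1}^ℓ and a string in {0,1}^n to an output in {1, ⊥}. Suppose: (completeness) Pr[Dec(sk, N_ρ(c)) = 1] ≥ 1 − δ where c ← Enc(sk); (soundness) for every fixed x* ∈ {0,1}^n, Pr_sk[Dec(sk, x*) = ⊥] ≥ 1 − μ; and (statistical pseudorandomness) m i.i.d. codewords c₁, …, c_m ← Enc(sk) (for a common uniform sk) are jointly ε-close in statistical distance to uniform on ({0,1}^n)^m, with ε ≤ 1/4. Then δ + μ ≥ 1 − √(2εn + 2√ε/m + ℓ/m). -/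
open Finset in
/-- Bernstein-type bound for the centred moment generating function of a `[0,1]`-valued variable. -/
theorem sum_mul_exp_centered_le {S : Type*} [Fintype S] (u T : S → ℝ) (hu0 : ∀ x, 0 ≤ u x)
    (hu1 : ∑ x, u x = 1) (hT : ∀ x, T x ∈ Set.Icc (0 : ℝ) 1) {t : ℝ} (ht0 : 0 ≤ t) (ht1 : t ≤ 1) :
    ∑ x, u x * Real.exp (t * (T x - ∑ y, u y * T y)) ≤ Real.exp (t ^ 2 / 4) := by
  set τ := ∑ y, u y * T y with hτ
  have hτ0 : 0 ≤ τ := sum_nonneg fun x _ => mul_nonneg (hu0 x) (hT x).1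
  have hτ1 : τ ≤ 1 := by
    rw [← hu1]
    exact sum_le_sum fun x _ => mul_le_of_le_one_right (hu0 x) (hT x).2
  have hpt : ∀ x, u x * Real.exp (t * (T x - τ)) ≤
      u x + (t + t ^ 2 * (1 - 2 * τ)) * (u x * T x) + (t ^ 2 * τ ^ 2 - t * τ) * u x := by
    intro x
    obtain ⟨h0, h1⟩ := hT x
    have habs : |t * (T x - τ)| ≤ 1 := by
      rw [abs_mul, abs_of_nonneg ht0]
      exact mul_le_one₀ ht1 (abs_nonneg _) (abs_le.2 ⟨by linarith, by linarith⟩)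
    have hexp := (abs_le.1 (Real.abs_exp_sub_one_sub_id_le habs)).2
    have hsq : t ^ 2 * T x ^ 2 ≤ t ^ 2 * T x :=
      mul_le_mul_of_nonneg_left (by nlinarith) (sq_nonneg t)
    calc u x * Real.exp (t * (T x - τ))
        ≤ u x * (1 + (t + t ^ 2 * (1 - 2 * τ)) * T x + (t ^ 2 * τ ^ 2 - t * τ)) :=
          mul_le_mul_of_nonneg_left (by nlinarith) (hu0 x)
      _ = _ := by ring
  calc ∑ x, u x * Real.exp (t * (T x - τ))
      ≤ ∑ x, (u x + (t + t ^ 2 * (1 - 2 * τ)) * (u x * T x) + (t ^ 2 * τ ^ 2 - t * τ) * u x) :=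
        sum_le_sum fun x _ => hpt x
    _ = 1 + t ^ 2 * (τ - τ ^ 2) := by
        rw [sum_add_distrib, sum_add_distrib, ← mul_sum, ← mul_sum, hu1, ← hτ]
        ring
    _ ≤ t ^ 2 / 4 + 1 := by nlinarith [mul_nonneg (sq_nonneg t) (sq_nonneg (τ - 1 / 2))]
    _ ≤ _ := Real.add_one_le_exp _

open Finset in
theorem sum_prod_eq_one {ι S : Type*} [Fintype ι] [DecidableEq ι] [Fintype S]
    (p : S → ℝ) (hp : ∑ x, p x = 1) : ∑ v : ι → S, ∏ i, p (v i) = 1 := by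
  have h := Fintype.prod_sum fun (_ : ι) (x : S) => p x
  simpa [hp] using h.symm

open Finset in
/-- The expectation of a sum of `m` i.i.d. terms is `m` times the expectation of one term. -/
theorem sum_prod_mul_sum {ι S : Type*} [Fintype ι] [DecidableEq ι] [Fintype S]
    (p g : S → ℝ) (hp : ∑ x, p x = 1) :
    ∑ v : ι → S, (∏ i, p (v i)) * ∑ j, g (v j) = Fintype.card ι * ∑ x, p x * g x := by
  have hcoord : ∀ j, ∑ v : ι → S, (∏ i, p (v i)) * g (v j) = ∑ x, p x * g x := by
    intro j
    have h := Fintype.prod_sum fun (i : ι) (x : S) => p x * if i = j then g x else 1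
    have hl : ∀ i : ι, ∑ x, p x * (if i = j then g x else 1) =
        if i = j then ∑ x, p x * g x else 1 := by
      intro i
      split_ifs <;> simp [hp]
    simp only [hl, prod_mul_distrib, prod_ite_eq', mem_univ, if_true] at h
    exact h.symm
  simp_rw [mul_sum]
  rw [sum_comm]
  simp [hcoord, mul_sum]

open Finset in
/-- If `m` i.i.d. samples from `P k`, for a common uniform `k`, are jointly `ε`-close to `m`
i.i.d. samples from `u`, then a `[0,1]`-valued test knowing `k` has a small average advantage
in distinguishing `P k` from `u`. -/
theorem mul_advantage_le {ι K S : Type*} [Fintype ι] [DecidableEq ι] [Fintype K]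
    [Nonempty K] [Fintype S] (P T : K → S → ℝ) (u : S → ℝ) (ε : ℝ)
    (hP0 : ∀ k x, 0 ≤ P k x) (hP1 : ∀ k, ∑ x, P k x = 1)
    (hu0 : ∀ x, 0 ≤ u x) (hu1 : ∑ x, u x = 1) (hT : ∀ k x, T k x ∈ Set.Icc (0 : ℝ) 1)
    (hclose : (1 / 2) * ∑ v : ι → S,
      |(∑ k, (Fintype.card K : ℝ)⁻¹ * ∏ i, P k (v i)) - ∏ i, u (v i)| ≤ ε)
    {t : ℝ} (ht0 : 0 ≤ t) (ht1 : t ≤ 1) :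
    (Fintype.card ι : ℝ) *
      (t * ∑ k, (Fintype.card K : ℝ)⁻¹ * (∑ x, P k x * T k x - ∑ x, u x * T k x)) ≤
      Real.log (Fintype.card K) + Fintype.card ι * (t ^ 2 / 4) + Fintype.card ι * (ε * t) := by
  set m : ℝ := (Fintype.card ι : ℝ) with hm
  have hm0 : 0 ≤ m := by positivity
  set w : ℝ := (Fintype.card K : ℝ)⁻¹ with hw
  have hw0 : 0 < w := by positivity
  have hw1 : ∑ _k : K, w = 1 := by simp [hw]
  set τ : K → ℝ := fun k => ∑ x, u x * T k x with hτ
  set E : K → (ι → S) → ℝ := fun k v => ∑ i, t * (T k (v i) - τ k) with hE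
  set Z : (ι → S) → ℝ := fun v => ∑ k, w * Real.exp (E k v) with hZ
  have hZ0 : ∀ v, 0 < Z v := fun v =>
    sum_pos (fun k _ => mul_pos hw0 (Real.exp_pos _)) univ_nonempty
  set Q : (ι → S) → ℝ := fun v => ∑ k, w * ∏ i, P k (v i) with hQ
  set U : (ι → S) → ℝ := fun v => ∏ i, u (v i) with hU
  have hU0 : ∀ v, 0 ≤ U v := fun v => prod_nonneg fun i _ => hu0 _
  have hU1 : ∑ v, U v = 1 := sum_prod_eq_one u hu1
  have hQ1 : ∑ v, Q v = 1 := by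
    simp only [hQ]
    rw [sum_comm]
    rw [← hw1]
    exact sum_congr rfl fun k _ => by rw [← mul_sum, sum_prod_eq_one _ (hP1 k), mul_one]
  -- lower bound on the `Q`-average of `log Z`
  have hlower : -Real.log (Fintype.card K) + m * (t * ∑ k, w * (∑ x, P k x * T k x - τ k)) ≤
      ∑ v, Q v * Real.log (Z v) := by
    have hk : ∀ k, -Real.log (Fintype.card K) + m * (t * (∑ x, P k x * T k x - τ k)) ≤
        ∑ v, (∏ i, P k (v i)) * Real.log (Z v) := by
      intro k
      have h1 : ∀ v, -Real.log (Fintype.card K) + E k v ≤ Real.log (Z v) := by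
        intro v
        have h2 : w * Real.exp (E k v) ≤ Z v :=
          single_le_sum (f := fun k => w * Real.exp (E k v))
            (fun k _ => (mul_pos hw0 (Real.exp_pos _)).le) (mem_univ k)
        have h3 := Real.log_le_log (mul_pos hw0 (Real.exp_pos _)) h2
        rwa [Real.log_mul hw0.ne' (Real.exp_pos _).ne', Real.log_exp, hw, Real.log_inv] at h3
      have h4 : ∑ v, (∏ i, P k (v i)) * E k v = m * (t * (∑ x, P k x * T k x - τ k)) := by
        rw [hE, sum_prod_mul_sum (P k) (fun x => t * (T k x - τ k)) (hP1 k)]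
        congr 1
        calc ∑ x, P k x * (t * (T k x - τ k))
            = ∑ x, (t * (P k x * T k x) - t * τ k * P k x) :=
              sum_congr rfl fun x _ => by ring
          _ = _ := by rw [sum_sub_distrib, ← mul_sum, ← mul_sum, hP1]; ring
      rw [← h4, ← mul_one (-Real.log (Fintype.card K)), ← sum_prod_eq_one (ι := ι) _ (hP1 k),
        mul_sum, ← sum_add_distrib]
      refine sum_le_sum fun v _ => ?_
      rw [mul_comm, ← mul_add]
      exact mul_le_mul_of_nonneg_left (h1 v) (prod_nonneg fun i _ => hP0 _ _)
    have hl : -Real.log (Fintype.card K) + m * (t * ∑ k, w * (∑ x, P k x * T k x - τ k)) =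
        ∑ k, w * (-Real.log (Fintype.card K) + m * (t * (∑ x, P k x * T k x - τ k))) := by
      simp_rw [mul_add, sum_add_distrib, ← sum_mul, hw1, one_mul, mul_sum]
      congr 1
      exact sum_congr rfl fun k _ => by ring
    have hr : ∑ v, Q v * Real.log (Z v) =
        ∑ k, w * ∑ v, (∏ i, P k (v i)) * Real.log (Z v) := by
      simp_rw [hQ, sum_mul, mul_sum]
      rw [sum_comm]
      simp_rw [mul_assoc]
    rw [hl, hr]
    exact sum_le_sum fun k _ => mul_le_mul_of_nonneg_left (hk k) hw0.le
  -- upper bound on the `U`-average of `log Z`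
  have hUZ : ∑ v, U v * Z v ≤ Real.exp (m * (t ^ 2 / 4)) := by
    have hk : ∀ k, ∑ v, U v * Real.exp (E k v) ≤ Real.exp (m * (t ^ 2 / 4)) := by
      intro k
      have h := Fintype.prod_sum fun (_ : ι) (x : S) => u x * Real.exp (t * (T k x - τ k))
      simp only [prod_mul_distrib, ← Real.exp_sum, prod_const, card_univ] at h
      rw [← h, hm, Real.exp_nat_mul]
      exact pow_le_pow_left₀ (sum_nonneg fun x _ => mul_nonneg (hu0 x) (Real.exp_pos _).le)
        (sum_mul_exp_centered_le u (T k) hu0 hu1 (hT k) ht0 ht1) _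
    calc ∑ v, U v * Z v = ∑ k, w * ∑ v, U v * Real.exp (E k v) := by
          simp_rw [hZ, mul_sum]
          rw [sum_comm]
          exact sum_congr rfl fun k _ => sum_congr rfl fun v _ => by ring
      _ ≤ ∑ k, w * Real.exp (m * (t ^ 2 / 4)) :=
          sum_le_sum fun k _ => mul_le_mul_of_nonneg_left (hk k) hw0.le
      _ = _ := by rw [← sum_mul, hw1, one_mul]
  have hupper : ∑ v, U v * Real.log (Z v) ≤ m * (t ^ 2 / 4) := by
    set b := m * (t ^ 2 / 4) with hb
    have hpt : ∀ v, U v * Real.log (Z v) ≤ (b - 1) * U v + Real.exp (-b) * (U v * Z v) := by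
      intro v
      have h := Real.log_le_sub_one_of_pos (mul_pos (Real.exp_pos (-b)) (hZ0 v))
      rw [Real.log_mul (Real.exp_pos _).ne' (hZ0 v).ne', Real.log_exp] at h
      calc U v * Real.log (Z v) ≤ U v * (b - 1 + Real.exp (-b) * Z v) :=
            mul_le_mul_of_nonneg_left (by linarith) (hU0 v)
        _ = _ := by ring
    calc ∑ v, U v * Real.log (Z v)
        ≤ ∑ v, ((b - 1) * U v + Real.exp (-b) * (U v * Z v)) := sum_le_sum fun v _ => hpt v
      _ = (b - 1) + Real.exp (-b) * ∑ v, U v * Z v := by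
          rw [sum_add_distrib, ← mul_sum, ← mul_sum, hU1, mul_one]
      _ ≤ (b - 1) + Real.exp (-b) * Real.exp b := by gcongr
      _ = b := by rw [← Real.exp_add]; simp
  -- `log Z` oscillates by at most `t * m`
  have hdiff : ∑ v, (Q v - U v) * Real.log (Z v) ≤ m * (ε * t) := by
    set C : ℝ := ∑ k, w * Real.exp (-(m * (t * τ k))) with hC
    have hC0 : 0 < C := sum_pos (fun k _ => mul_pos hw0 (Real.exp_pos _)) univ_nonempty
    have hEexp : ∀ k v, E k v = t * (∑ i, T k (v i)) - m * (t * τ k) := by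
      intro k v
      simp only [hE]
      rw [← mul_sum, sum_sub_distrib, sum_const, card_univ, nsmul_eq_mul]
      ring
    have hlo : ∀ v, C ≤ Z v := by
      intro v
      refine sum_le_sum fun k _ => mul_le_mul_of_nonneg_left (Real.exp_le_exp.2 ?_) hw0.le
      have : 0 ≤ t * ∑ i, T k (v i) := mul_nonneg ht0 (sum_nonneg fun i _ => (hT k _).1)
      linarith [hEexp k v]
    have hhi : ∀ v, Z v ≤ Real.exp (t * m) * C := by
      intro v
      rw [hC, mul_sum]
      refine sum_le_sum fun k _ => ?_
      rw [mul_left_comm, ← Real.exp_add]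
      refine mul_le_mul_of_nonneg_left (Real.exp_le_exp.2 ?_) hw0.le
      have h1 : ∑ i, T k (v i) ≤ m := by
        calc ∑ i, T k (v i) ≤ ∑ _i : ι, (1 : ℝ) := sum_le_sum fun i _ => (hT k _).2
          _ = m := by simp [hm]
      have h2 := mul_le_mul_of_nonneg_left h1 ht0
      linarith [hEexp k v]
    set L := Real.log C + t * m / 2 with hL
    have habs : ∀ v, |Real.log (Z v) - L| ≤ t * m / 2 := by
      intro v
      have h1 := Real.log_le_log hC0 (hlo v)
      have h2 := Real.log_le_log (hZ0 v) (hhi v)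
      rw [Real.log_mul (Real.exp_pos _).ne' hC0.ne', Real.log_exp] at h2
      exact abs_le.2 ⟨by linarith, by linarith⟩
    calc ∑ v, (Q v - U v) * Real.log (Z v)
        = ∑ v, ((Q v - U v) * (Real.log (Z v) - L) + (Q v - U v) * L) :=
          sum_congr rfl fun v _ => by ring
      _ = ∑ v, (Q v - U v) * (Real.log (Z v) - L) := by
          rw [sum_add_distrib, ← sum_mul, sum_sub_distrib, hQ1, hU1]
          ring
      _ ≤ ∑ v, |Q v - U v| * (t * m / 2) := by
          refine sum_le_sum fun v _ => (le_abs_self _).trans ?_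
          rw [abs_mul]
          exact mul_le_mul_of_nonneg_left (habs v) (abs_nonneg _)
      _ = t * m * ((1 / 2) * ∑ v, |Q v - U v|) := by
          rw [← sum_mul]
          ring
      _ ≤ t * m * ε := mul_le_mul_of_nonneg_left hclose (by positivity)
      _ = _ := by ring
  simp_rw [sub_mul, sum_sub_distrib] at hdiff
  linarith

theorem noiseK_nonneg {ρ : ℝ} (hρ : ρ ∈ Set.Icc (0 : ℝ) 1) {n : ℕ} (x y : Fin n → Bool) :
    0 ≤ noiseK ρ x y := by
  obtain ⟨h0, h1⟩ := hρ
  refine Finset.prod_nonneg fun i _ => ?_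
  split_ifs <;> linarith

theorem noiseK_comm (ρ : ℝ) {n : ℕ} (x y : Fin n → Bool) : noiseK ρ x y = noiseK ρ y x := by
  simp only [noiseK, eq_comm]

theorem sum_noiseK (ρ : ℝ) {n : ℕ} (x : Fin n → Bool) : ∑ y, noiseK ρ x y = 1 := by
  have h := Fintype.prod_sum fun (i : Fin n) (b : Bool) =>
    if b = x i then (1 + ρ) / 2 else (1 - ρ) / 2
  have hbit : ∀ i : Fin n, ∑ b : Bool, (if b = x i then (1 + ρ) / 2 else (1 - ρ) / 2) = 1 := by
    intro i
    cases x i <;> simp <;> ring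
  simp only [hbit, Finset.prod_const_one] at h
  exact h.symm

/-- The noise channel preserves the uniform distribution. -/
theorem sum_sum_noiseK_mul (ρ : ℝ) {n : ℕ} (f : (Fin n → Bool) → ℝ) :
    ∑ x, ∑ y, noiseK ρ x y * f y = ∑ y, f y := by
  rw [Finset.sum_comm]
  refine Finset.sum_congr rfl fun y _ => ?_
  simp_rw [← Finset.sum_mul, noiseK_comm ρ _ y, sum_noiseK, one_mul]

/-- **No statistically pseudorandom codes in the standard model.**
Let `ρ ∈ [0,1]`, let `sk` be uniform on `{0,1}^ℓ`, let `Enc` be a randomized encoder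
(given by its kernel `Enc k c = Pr[Enc(k) = c]`), and let `Dec` be a randomized decoder
with output in `{1, ⊥}` (given by `Dec k x = Pr[Dec(k, x) = 1]`).  Suppose:
(completeness) `Pr[Dec(sk, N_ρ(c)) = 1] ≥ 1 − δ` where `c ← Enc(sk)`;
(soundness) for every fixed `x*`, `Pr_sk[Dec(sk, x*) = ⊥] ≥ 1 − μ`; and
(statistical pseudorandomness) `m` i.i.d. codewords from `Enc(sk)` (for a common
uniform `sk`) are jointly `ε`-close in statistical distance to uniform on
`({0,1}^n)^m`, with `ε ≤ 1/4`.  Then `δ + μ ≥ 1 − √(2εn + 2√ε/m + ℓ/m)`. -/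
theorem no_statistical_prc {l n m : ℕ} (hm : 0 < m)
    (ρ : ℝ) (hρ : ρ ∈ Set.Icc (0 : ℝ) 1)
    (Enc : (Fin l → Bool) → (Fin n → Bool) → ℝ)
    (hE0 : ∀ k c, 0 ≤ Enc k c) (hE1 : ∀ k, ∑ c, Enc k c = 1)
    (Dec : (Fin l → Bool) → (Fin n → Bool) → ℝ)
    (hDec : ∀ k x, Dec k x ∈ Set.Icc (0 : ℝ) 1)
    (δ μ ε : ℝ) (hε4 : ε ≤ 1 / 4)
    (hcomplete : 1 - δ ≤
      ∑ k, (2 ^ l : ℝ)⁻¹ * ∑ c, Enc k c * ∑ ct, noiseK ρ c ct * Dec k ct)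
    (hsound : ∀ x : Fin n → Bool, 1 - μ ≤ ∑ k, (2 ^ l : ℝ)⁻¹ * (1 - Dec k x))
    (hpseudo : (1 / 2) * ∑ v : Fin m → (Fin n → Bool),
        |(∑ k, (2 ^ l : ℝ)⁻¹ * ∏ i, Enc k (v i)) - ((2 ^ n : ℝ) ^ m)⁻¹| ≤ ε) :
    1 - Real.sqrt (2 * ε * n + 2 * Real.sqrt ε / m + l / m) ≤ δ + μ := by
  set T : (Fin l → Bool) → (Fin n → Bool) → ℝ := fun k c => ∑ ct, noiseK ρ c ct * Dec k ct with hTdef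
  have hT : ∀ k c, T k c ∈ Set.Icc (0 : ℝ) 1 := by
    refine fun k c => ⟨Finset.sum_nonneg fun y _ =>
      mul_nonneg (noiseK_nonneg hρ c y) (hDec k y).1, ?_⟩
    rw [← sum_noiseK ρ c]
    exact Finset.sum_le_sum fun y _ =>
      mul_le_of_le_one_right (noiseK_nonneg hρ c y) (hDec k y).2
  have hn1 : ∑ _x : Fin n → Bool, (2 ^ n : ℝ)⁻¹ = 1 := by simp
  have hl1 : ∑ _k : Fin l → Bool, (2 ^ l : ℝ)⁻¹ = 1 := by simp
  set A := ∑ k, (2 ^ l : ℝ)⁻¹ * (∑ c, Enc k c * T k c - ∑ c, (2 ^ n : ℝ)⁻¹ * T k c) with hA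
  have hε0 : 0 ≤ ε := le_trans (by positivity) hpseudo
  have hτ : ∑ k, (2 ^ l : ℝ)⁻¹ * ∑ c, (2 ^ n : ℝ)⁻¹ * T k c ≤ μ := by
    have hx : ∀ x : Fin n → Bool, ∑ k, (2 ^ l : ℝ)⁻¹ * Dec k x ≤ μ := by
      intro x
      have h := hsound x
      simp_rw [mul_sub, mul_one, Finset.sum_sub_distrib, hl1] at h
      linarith
    calc ∑ k, (2 ^ l : ℝ)⁻¹ * ∑ c, (2 ^ n : ℝ)⁻¹ * T k c
        = ∑ x, (2 ^ n : ℝ)⁻¹ * ∑ k, (2 ^ l : ℝ)⁻¹ * Dec k x := by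
          have hk : ∀ k, ∑ c, (2 ^ n : ℝ)⁻¹ * T k c = ∑ x, (2 ^ n : ℝ)⁻¹ * Dec k x := fun k => by
            rw [← Finset.mul_sum, ← Finset.mul_sum, sum_sum_noiseK_mul ρ (Dec k)]
          simp_rw [hk, Finset.mul_sum]
          rw [Finset.sum_comm]
          exact Finset.sum_congr rfl fun x _ => Finset.sum_congr rfl fun k _ => by ring
      _ ≤ ∑ _x : Fin n → Bool, (2 ^ n : ℝ)⁻¹ * μ :=
          Finset.sum_le_sum fun x _ => mul_le_mul_of_nonneg_left (hx x) (by positivity)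
      _ = μ := by rw [← Finset.sum_mul, hn1, one_mul]
  have hAge : 1 - δ - μ ≤ A := by
    simp_rw [hA, mul_sub, Finset.sum_sub_distrib]
    linarith
  suffices hmain : A ≤ Real.sqrt (2 * ε * n + 2 * Real.sqrt ε / m + l / m) by linarith
  rcases le_or_gt A 0 with hA0 | hA0
  · exact hA0.trans (Real.sqrt_nonneg _)
  have hA1 : A ≤ 1 := by
    rw [← hl1]
    refine Finset.sum_le_sum fun k _ => mul_le_of_le_one_right (by positivity) ?_
    have h1 : ∑ c, Enc k c * T k c ≤ 1 := by
      rw [← hE1 k]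
      exact Finset.sum_le_sum fun c _ => mul_le_of_le_one_right (hE0 k c) (hT k c).2
    have h2 : 0 ≤ ∑ c, (2 ^ n : ℝ)⁻¹ * T k c :=
      Finset.sum_nonneg fun c _ => mul_nonneg (by positivity) (hT k c).1
    linarith
  have hn : 1 ≤ n := by
    by_contra! h
    obtain rfl : n = 0 := by omega
    have hEnc : ∀ k c, Enc k c = 1 := fun k c => by
      rw [← hE1 k, Fintype.sum_subsingleton _ c]
    simp [hA, hEnc] at hA0
  have hcard : (Fintype.card (Fin l → Bool) : ℝ) = 2 ^ l := by simp
  have key := mul_advantage_le (ι := Fin m) Enc T (fun _ => (2 ^ n : ℝ)⁻¹) ε hE0 hE1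
    (fun _ => by positivity) hn1 hT (by simpa [hcard] using hpseudo) hA0.le hA1
  rw [hcard, ← hA, Real.log_pow, Fintype.card_fin] at key
  have hm0 : (0 : ℝ) < m := by exact_mod_cast hm
  have hn' : (1 : ℝ) ≤ n := by exact_mod_cast hn
  have hkey : A * A ≤ l / m * Real.log 2 + A ^ 2 / 4 + ε * A := by
    rw [← mul_le_mul_iff_right₀ hm0]
    calc m * (A * A) ≤ _ := key
      _ = _ := by field_simp
  have hlm : (0 : ℝ) ≤ l / m := by positivity
  have hlog : l / m * Real.log 2 ≤ l / m * (3 / 4) :=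
    mul_le_mul_of_nonneg_left (by linarith [Real.log_two_lt_d9]) hlm
  have hεA : ε * A ≤ ε := mul_le_of_le_one_right hε0 hA1
  have hεn : ε ≤ ε * n := le_mul_of_one_le_right hε0 hn'
  have hs : 0 ≤ 2 * Real.sqrt ε / m := by positivity
  refine Real.le_sqrt_of_sq_le ?_
  nlinarith
end
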